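/- For every integer m ≥ 7, the universal adjoint Adj_{m−3} of the (m−3)-dimensional ABHY associahedron does not admit an AV-representation: there do not exist a triangulation T of the m-gon and a square matrix A, indexed by the diagonals of the m-gon not in T, with entries in the polynomial ring ℂ[X_{ij} : (i,j) ∈ T], such that Adj_{m−3} = det(D + A), where D is the diagonal matrix whose diagonal entry in the position of a diagonal (i,j) ∉ T is the variable X_{ij}. -/

import Mathlib

/-- `(i, j)` is a diagonal of the convex `m`-gon with vertices `1, …, m`:
`1 ≤ i < j ≤ m`, `j - i ≥ 2`, and `(i, j) ≠ (1, m)`. -/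
def IsDiag (m : ℕ) (p : ℕ × ℕ) : Prop :=
  1 ≤ p.1 ∧ p.1 + 2 ≤ p.2 ∧ p.2 ≤ m ∧ ¬(p.1 = 1 ∧ p.2 = m)

/-- Two diagonals `(i,j)` and `(k,l)` cross if `i < k < j < l` or `k < i < l < j`. -/
def Crossing (p q : ℕ × ℕ) : Prop :=
  (p.1 < q.1 ∧ q.1 < p.2 ∧ p.2 < q.2) ∨ (q.1 < p.1 ∧ p.1 < q.2 ∧ q.2 < p.2)

open scoped Classical in
/-- The finite set of diagonals of the `m`-gon. -/
noncomputable def diagonals (m : ℕ) : Finset (ℕ × ℕ) :=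
  (Finset.range (m + 1) ×ˢ Finset.range (m + 1)).filter (IsDiag m)

/-- A triangulation of the `m`-gon: a set of `m - 3` pairwise non-crossing diagonals. -/
def IsTriangulation (m : ℕ) (T : Finset (ℕ × ℕ)) : Prop :=
  T.card = m - 3 ∧ (∀ p ∈ T, IsDiag m p) ∧ ∀ p ∈ T, ∀ q ∈ T, ¬ Crossing p q

open scoped Classical in
/-- The finite set of all triangulations of the `m`-gon. -/
noncomputable def triangulations (m : ℕ) : Finset (Finset (ℕ × ℕ)) :=
  (diagonals m).powerset.filter (IsTriangulation m)

/-- The universal adjoint `Adj_{m-3} = Σ_T Π_{(i,j) ∉ T} X_{ij}` of the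
`(m-3)`-dimensional ABHY associahedron, as an element of the polynomial ring over `ℂ`
with one variable `X (i, j)` for each pair `(i, j)`; only the variables indexed by
diagonals of the `m`-gon occur, and polynomial rings on fewer vertices are included in
those on more vertices via the inclusion of diagonals. -/
noncomputable def Adj (m : ℕ) : MvPolynomial (ℕ × ℕ) ℂ :=
  ∑ T ∈ triangulations m, ∏ d ∈ diagonals m \ T, MvPolynomial.X d

/-- `Adj_{m-3}` admits an AV-representation: there are a triangulation `T` of the `m`-gon
and a square matrix `A`, indexed by the diagonals of the `m`-gon not in `T`, with entries
in `ℂ[X_{ij} : (i,j) ∈ T]`, such that `Adj_{m-3} = det(diag(X_{ij} : (i,j) ∉ T) + A)`. -/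
def HasAVRep (m : ℕ) : Prop :=
  ∃ T : Finset (ℕ × ℕ), IsTriangulation m T ∧
    ∃ A : Matrix {d // d ∈ diagonals m \ T} {d // d ∈ diagonals m \ T}
        (MvPolynomial (ℕ × ℕ) ℂ),
      (∀ i j, A i j ∈ MvPolynomial.supported ℂ (↑T : Set (ℕ × ℕ))) ∧
      Adj m = (Matrix.diagonal
          (fun d : {d // d ∈ diagonals m \ T} => MvPolynomial.X d.val) + A).det

instance (p q : ℕ × ℕ) : Decidable (Crossing p q) := by unfold Crossing; infer_instance
instance (m : ℕ) (p : ℕ × ℕ) : Decidable (IsDiag m p) := by unfold IsDiag; infer_instance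

theorem mem_diagonals {m : ℕ} {p : ℕ × ℕ} : p ∈ diagonals m ↔ IsDiag m p := by
  simp only [diagonals, Finset.mem_filter, Finset.mem_product, Finset.mem_range, IsDiag]
  omega

theorem mem_triangulations {m : ℕ} {T : Finset (ℕ × ℕ)} :
    T ∈ triangulations m ↔ IsTriangulation m T := by
  simp only [triangulations, Finset.mem_filter, Finset.mem_powerset, and_iff_right_iff_imp]
  exact fun h p hp => mem_diagonals.2 (h.2.1 p hp)

/-- The order embedding `ℕ → ℕ` that omits `v`, relabelling the vertices of a polygon from which
the vertex `v` has been cut off. -/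
def skip (v x : ℕ) : ℕ := if x < v then x else x + 1

/-- The map on diagonals induced by `skip v`. -/
def skipDiag (v : ℕ) (p : ℕ × ℕ) : ℕ × ℕ := (skip v p.1, skip v p.2)

theorem skipDiag_injective (v : ℕ) : Function.Injective (skipDiag v) := by
  rintro ⟨a, b⟩ ⟨c, d⟩ h
  simp only [skipDiag, skip, Prod.mk.injEq] at h ⊢
  grind

theorem crossing_skipDiag {v : ℕ} {p q : ℕ × ℕ} :
    Crossing (skipDiag v p) (skipDiag v q) ↔ Crossing p q := by
  simp only [Crossing, skipDiag, skip]
  grind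

theorem not_crossing_ear {v : ℕ} {p : ℕ × ℕ} :
    ¬ Crossing (skipDiag (v + 1) p) (v, v + 2) := by
  simp only [Crossing, skipDiag, skip]
  grind

theorem isDiag_skipDiag {k v : ℕ} {p : ℕ × ℕ} (hvk : v + 2 ≤ k + 1)
    (hp : IsDiag k p) : IsDiag (k + 1) (skipDiag (v + 1) p) := by
  simp only [IsDiag, skipDiag, skip] at *
  grind

theorem skipDiag_ne_ear {k v : ℕ} {p : ℕ × ℕ} (hp : IsDiag k p) :
    skipDiag (v + 1) p ≠ (v, v + 2) := by
  simp only [IsDiag, skipDiag, skip, ne_eq, Prod.mk.injEq] at *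
  grind

theorem exists_skipDiag_eq {k v : ℕ} {t : ℕ × ℕ} (hv : 1 ≤ v) (hvk : v + 2 ≤ k + 1)
    (ht : IsDiag (k + 1) t) (hne : t ≠ (v, v + 2)) (hc : ¬ Crossing t (v, v + 2)) :
    ∃ p, IsDiag k p ∧ skipDiag (v + 1) p = t := by
  obtain ⟨a, b⟩ := t
  refine ⟨(if a < v + 1 then a else a - 1, if b < v + 1 then b else b - 1), ?_⟩
  simp only [IsDiag, Crossing, skipDiag, skip, ne_eq, Prod.mk.injEq] at *
  grind

/-- The diagonals of the `k`-gon induced by a set of diagonals of the `(k+1)`-gon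
after cutting off the vertex `v`. -/
noncomputable def cutEar (k v : ℕ) (N : Finset (ℕ × ℕ)) : Finset (ℕ × ℕ) :=
  (diagonals k).filter fun p => skipDiag v p ∈ N

theorem mem_cutEar {k v : ℕ} {N : Finset (ℕ × ℕ)} {p : ℕ × ℕ} :
    p ∈ cutEar k v N ↔ IsDiag k p ∧ skipDiag v p ∈ N := by
  simp [cutEar, mem_diagonals]

theorem image_cutEar {k v : ℕ} {N : Finset (ℕ × ℕ)} (hN : ∀ p ∈ N, IsDiag (k + 1) p)
    (hc : ∀ p ∈ N, ∀ q ∈ N, ¬ Crossing p q) (he : (v, v + 2) ∈ N) :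
    (cutEar k (v + 1) N).image (skipDiag (v + 1)) = N.erase (v, v + 2) := by
  have h := hN _ he
  ext t
  simp only [Finset.mem_image, mem_cutEar, Finset.mem_erase]
  constructor
  · rintro ⟨p, ⟨hp, hpN⟩, rfl⟩
    exact ⟨skipDiag_ne_ear hp, hpN⟩
  · rintro ⟨hne, ht⟩
    obtain ⟨p, hp, rfl⟩ := exists_skipDiag_eq h.1 h.2.2.1 (hN t ht) hne (hc _ ht _ he)
    exact ⟨p, ⟨hp, ht⟩, rfl⟩

theorem card_cutEar {k v : ℕ} {N : Finset (ℕ × ℕ)} (hN : ∀ p ∈ N, IsDiag (k + 1) p)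
    (hc : ∀ p ∈ N, ∀ q ∈ N, ¬ Crossing p q) (he : (v, v + 2) ∈ N) :
    (cutEar k (v + 1) N).card + 1 = N.card := by
  rw [← Finset.card_image_of_injective _ (skipDiag_injective (v + 1)), image_cutEar hN hc he,
    Finset.card_erase_add_one he]

theorem exists_ear_not_crossing {k : ℕ} {N : Finset (ℕ × ℕ)} (hN : ∀ p ∈ N, IsDiag k p)
    (hc : ∀ p ∈ N, ∀ q ∈ N, ¬ Crossing p q) (hne : N.Nonempty) :
    ∃ v, IsDiag k (v, v + 2) ∧ ∀ p ∈ N, ¬ Crossing (v, v + 2) p := by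
  obtain ⟨⟨i, j⟩, hij, hmin⟩ := N.exists_min_image (fun p => p.2 - p.1) hne
  have h := hN _ hij
  refine ⟨i, ?_, fun p hp => ?_⟩
  · simp only [IsDiag] at *
    omega
  · have h1 := hmin p hp
    have h2 := hc _ hij p hp
    have h3 := hN p hp
    simp only [IsDiag, Crossing] at *
    omega

theorem crossing_comm {p q : ℕ × ℕ} : Crossing p q ↔ Crossing q p := by
  simp only [Crossing]
  tauto

theorem not_crossing_self (p : ℕ × ℕ) : ¬ Crossing p p := by
  simp only [Crossing]
  omega

theorem not_crossing_insert {N : Finset (ℕ × ℕ)} {e : ℕ × ℕ}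
    (hc : ∀ p ∈ N, ∀ q ∈ N, ¬ Crossing p q) (he : ∀ p ∈ N, ¬ Crossing e p) :
    ∀ p ∈ insert e N, ∀ q ∈ insert e N, ¬ Crossing p q := by
  intro p hp q hq
  rw [Finset.mem_insert] at hp hq
  rcases hp with rfl | hp <;> rcases hq with rfl | hq
  · exact not_crossing_self _
  · exact he q hq
  · exact fun h => he p hp (crossing_comm.1 h)
  · exact hc p hp q hq

theorem card_le_of_not_crossing {k : ℕ} {N : Finset (ℕ × ℕ)} (hN : ∀ p ∈ N, IsDiag k p)
    (hc : ∀ p ∈ N, ∀ q ∈ N, ¬ Crossing p q) : N.card ≤ k - 3 := by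
  induction k generalizing N with
  | zero =>
    rw [Nat.zero_sub, Nat.le_zero, Finset.card_eq_zero, Finset.eq_empty_iff_forall_notMem]
    intro p hp
    have := hN p hp
    simp only [IsDiag] at this
    omega
  | succ k ih =>
    rcases N.eq_empty_or_nonempty with rfl | hne
    · simp
    obtain ⟨v, hv, hvN⟩ := exists_ear_not_crossing hN hc hne
    have hN' : ∀ p ∈ insert (v, v + 2) N, IsDiag (k + 1) p := by
      simpa [hv] using hN
    have hc' := not_crossing_insert hc hvN
    have h1 := card_cutEar hN' hc' (Finset.mem_insert_self _ _)
    have h2 := ih (N := cutEar k (v + 1) (insert (v, v + 2) N))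
      (fun p hp => (mem_cutEar.1 hp).1)
      (fun p hp q hq h => hc' _ (mem_cutEar.1 hp).2 _ (mem_cutEar.1 hq).2
        (crossing_skipDiag.2 h))
    have h3 := Finset.card_le_card (Finset.subset_insert (v, v + 2) N)
    simp only [IsDiag] at hv
    omega

theorem IsTriangulation.exists_ear {k : ℕ} {T : Finset (ℕ × ℕ)} (hT : IsTriangulation k T)
    (hk : 4 ≤ k) : ∃ v, (v, v + 2) ∈ T := by
  obtain ⟨hcard, hN, hc⟩ := hT
  obtain ⟨v, hv, hvN⟩ := exists_ear_not_crossing hN hc (Finset.card_pos.1 (by omega))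
  refine ⟨v, by_contra fun hmem => ?_⟩
  have h := card_le_of_not_crossing (k := k) (N := insert (v, v + 2) T) (by simpa [hv] using hN)
    (not_crossing_insert hc hvN)
  rw [Finset.card_insert_of_notMem hmem] at h
  omega

theorem IsTriangulation.cutEar {k v : ℕ} {T : Finset (ℕ × ℕ)} (hT : IsTriangulation (k + 1) T)
    (he : (v, v + 2) ∈ T) : IsTriangulation k (cutEar k (v + 1) T) := by
  have h := card_cutEar hT.2.1 hT.2.2 he
  refine ⟨by have := hT.1; omega, fun p hp => (mem_cutEar.1 hp).1, fun p hp q hq h => ?_⟩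
  exact hT.2.2 _ (mem_cutEar.1 hp).2 _ (mem_cutEar.1 hq).2 (crossing_skipDiag.2 h)

/-- The diagonals in `T` crossed by some diagonal in the list `s`. -/
def crossed (T : Finset (ℕ × ℕ)) (s : List (ℕ × ℕ)) : Finset (ℕ × ℕ) :=
  T.filter fun t => ∃ x ∈ s, Crossing x t

/-- The diagonals in the list `s` are pairwise non-crossing. -/
def NonCrossing (s : List (ℕ × ℕ)) : Prop := ∀ x ∈ s, ∀ y ∈ s, ¬ Crossing x y

instance (s : List (ℕ × ℕ)) : Decidable (NonCrossing s) := by unfold NonCrossing; infer_instance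

/-- The number of triangulations `T'` with `T' \ T = s` (for `s` crossing at least `s.length`
diagonals of `T`). -/
def expectedMinor (T : Finset (ℕ × ℕ)) (s : List (ℕ × ℕ)) : ℕ :=
  if NonCrossing s ∧ (crossed T s).card = s.length then 1 else 0

/-- The list `s` consists of distinct diagonals outside of `T`, crossing at least `s.length`
diagonals of `T`, and the associated minor is expected to be `n`. -/
def IsExpected (k : ℕ) (T : Finset (ℕ × ℕ)) (s : List (ℕ × ℕ)) (n : ℕ) : Prop :=
  s.Nodup ∧ (∀ x ∈ s, IsDiag k x ∧ x ∉ T) ∧ s.length ≤ (crossed T s).card ∧ expectedMinor T s = n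

instance (k : ℕ) (T : Finset (ℕ × ℕ)) (s : List (ℕ × ℕ)) (n : ℕ) :
    Decidable (IsExpected k T s n) := by
  unfold IsExpected; infer_instance

/-- The principal minor of `M` with rows and columns listed by `s`. -/
def minor {ι : Type*} (M : ι → ι → ℂ) (s : List ι) : ℂ :=
  Matrix.det (Matrix.of fun i j : Fin s.length => M s[i] s[j])

/-- There is a complex matrix with the principal minors forced by an AV-representation of the
adjoint of the `k`-gon with respect to the triangulation `T`. -/
def HasMinors (k : ℕ) (T : Finset (ℕ × ℕ)) : Prop :=
  ∃ M : ℕ × ℕ → ℕ × ℕ → ℂ, ∀ s n, IsExpected k T s n → minor M s = n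

theorem minor_map {ι κ : Type*} (M : ι → ι → ℂ) (f : κ → ι) (s : List κ) :
    minor M (s.map f) = minor (fun i j => M (f i) (f j)) s := by
  unfold minor
  rw [← Matrix.det_submatrix_equiv_self (finCongr (List.length_map f).symm)]
  congr 1
  ext i j
  simp

theorem crossed_map_skipDiag {k v : ℕ} {T : Finset (ℕ × ℕ)} (hT : IsTriangulation (k + 1) T)
    (he : (v, v + 2) ∈ T) (s : List (ℕ × ℕ)) :
    crossed T (s.map (skipDiag (v + 1))) =
      (crossed (cutEar k (v + 1) T) s).image (skipDiag (v + 1)) := by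
  have hi := image_cutEar hT.2.1 hT.2.2 he
  ext t
  simp only [crossed, Finset.mem_filter, List.mem_map, exists_exists_and_eq_and,
    Finset.mem_image]
  constructor
  · rintro ⟨ht, x, hx, hxt⟩
    have hmem : t ∈ T.erase (v, v + 2) :=
      Finset.mem_erase.2 ⟨fun h => not_crossing_ear (h ▸ hxt), ht⟩
    rw [← hi, Finset.mem_image] at hmem
    obtain ⟨p, hp, rfl⟩ := hmem
    exact ⟨p, ⟨hp, x, hx, crossing_skipDiag.1 hxt⟩, rfl⟩
  · rintro ⟨p, ⟨hp, x, hx, hxp⟩, rfl⟩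
    exact ⟨(mem_cutEar.1 hp).2, x, hx, crossing_skipDiag.2 hxp⟩

theorem IsExpected.map_skipDiag {k v n : ℕ} {T : Finset (ℕ × ℕ)} {s : List (ℕ × ℕ)}
    (hT : IsTriangulation (k + 1) T) (he : (v, v + 2) ∈ T)
    (hs : IsExpected k (_root_.cutEar k (v + 1) T) s n) :
    IsExpected (k + 1) T (s.map (skipDiag (v + 1))) n := by
  obtain ⟨hnd, hd, hlen, hn⟩ := hs
  have hv := hT.2.1 _ he
  have hcard : (crossed T (s.map (skipDiag (v + 1)))).card =
      (crossed (_root_.cutEar k (v + 1) T) s).card := by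
    rw [crossed_map_skipDiag hT he, Finset.card_image_of_injective _ (skipDiag_injective _)]
  refine ⟨hnd.map (skipDiag_injective _), ?_, ?_, ?_⟩
  · simp only [List.mem_map, forall_exists_index, and_imp, forall_apply_eq_imp_iff₂]
    intro x hx
    exact ⟨isDiag_skipDiag hv.2.2.1 (hd x hx).1,
      fun h => (hd x hx).2 (mem_cutEar.2 ⟨(hd x hx).1, h⟩)⟩
  · simpa [hcard] using hlen
  · rw [← hn]
    have h : NonCrossing (s.map (skipDiag (v + 1))) ↔ NonCrossing s := by
      unfold NonCrossing
      simp only [List.forall_mem_map, crossing_skipDiag]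
    simp only [expectedMinor, h, hcard, List.length_map]

theorem HasMinors.cutEar {k v : ℕ} {T : Finset (ℕ × ℕ)} (hT : IsTriangulation (k + 1) T)
    (he : (v, v + 2) ∈ T) (h : HasMinors (k + 1) T) : HasMinors k (cutEar k (v + 1) T) := by
  obtain ⟨M, hM⟩ := h
  refine ⟨fun i j => M (skipDiag (v + 1) i) (skipDiag (v + 1) j), fun s n hs => ?_⟩
  rw [← minor_map]
  exact hM _ _ (hs.map_skipDiag hT he)

theorem exists_hasMinors_seven {m : ℕ} (hm : 7 ≤ m) {T : Finset (ℕ × ℕ)}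
    (hT : IsTriangulation m T) (h : HasMinors m T) :
    ∃ T', IsTriangulation 7 T' ∧ HasMinors 7 T' := by
  induction m, hm using Nat.le_induction generalizing T with
  | base => exact ⟨T, hT, h⟩
  | succ k hk ih =>
    obtain ⟨v, hv⟩ := hT.exists_ear (by omega)
    exact ih (hT.cutEar hv) (h.cutEar hT hv)

theorem coeff_det_diagonal_add {n : Type*} [Fintype n] [DecidableEq n] (A : Matrix n n ℂ)
    (S : Finset n) :
    ((Matrix.diagonal (fun i => if i ∈ S then 0 else Polynomial.X) +
      A.map Polynomial.C).det).coeff Sᶜ.card = (A.submatrix ((↑) : S → n) (↑)).det := by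
  let D : Matrix n n (Polynomial ℂ) := Matrix.diagonal fun i => if i ∈ S then 0 else Polynomial.X
  have hrow (s : Finset n) :
      Matrix.det (Matrix.of (s.piecewise (A.map Polynomial.C).row D.row)) =
      if S ⊆ s then Polynomial.C (A.submatrix ((↑) : s → n) (↑)).det * Polynomial.X ^ sᶜ.card
      else 0 := by
    let P : Matrix n n ℂ := Matrix.of (s.piecewise A.row (1 : Matrix n n ℂ).row)
    have h1 : Matrix.of (s.piecewise (A.map Polynomial.C).row D.row) =
        Matrix.of fun i j => (if i ∈ s then 1 else if i ∈ S then 0 else Polynomial.X) *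
          P.map Polynomial.C i j := by
      ext1 i j
      by_cases hi : i ∈ s
      · simp [hi, P]
      · by_cases hj : i = j
        · subst hj
          simp [hi, D, P]
        · simp [hi, hj, D, P]
    rw [h1, Matrix.det_mul_column, ← Matrix.det_piecewise_one_eq_submatrix_det,
      ← Finset.prod_mul_prod_compl s, show (P.map Polynomial.C).det = Polynomial.C P.det from
          (RingHom.map_det Polynomial.C _).symm]
    rw [Finset.prod_congr rfl (g := fun _ => 1) fun i hi => if_pos hi, Finset.prod_const_one,
      one_mul]
    split_ifs with hS
    · rw [Finset.prod_congr rfl (g := fun _ => Polynomial.X), Finset.prod_const, mul_comm]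
      intro i hi
      rw [Finset.mem_compl] at hi
      rw [if_neg hi, if_neg fun h => hi (hS h)]
    · obtain ⟨i, hiS, his⟩ := Finset.not_subset.1 hS
      rw [Finset.prod_eq_zero (Finset.mem_compl.2 his), zero_mul]
      rw [if_neg his, if_pos hiS]
  have hsum : (A.map Polynomial.C + D).det =
      ∑ s : Finset n, Matrix.det (Matrix.of (s.piecewise (A.map Polynomial.C).row D.row)) :=
    (Matrix.detRowAlternating (n := n) (R := Polynomial ℂ)).map_add_univ
      (A.map Polynomial.C).row D.row
  rw [add_comm, hsum, Polynomial.finsetSum_coeff]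
  simp only [hrow]
  rw [Finset.sum_eq_single S]
  · simp
  · intro s _ hs
    split_ifs with h
    · rw [Polynomial.coeff_C_mul_X_pow, if_neg]
      intro hc
      have := Finset.card_lt_card (Finset.ssubset_iff_subset_ne.2 ⟨h, hs.symm⟩)
      have h1 := Finset.card_add_card_compl s
      have h2 := Finset.card_add_card_compl S
      omega
    · simp
  · simp

/-- Evaluation of the variables in `T` at `1`, of the variables in `S` at `0`, and of all other
variables at `X`. -/
noncomputable def evalOutside (T S : Finset (ℕ × ℕ)) :
    MvPolynomial (ℕ × ℕ) ℂ →ₐ[ℂ] Polynomial ℂ :=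
  MvPolynomial.aeval fun d => if d ∈ T then 1 else if d ∈ S then 0 else Polynomial.X

theorem evalOutside_of_mem_supported {T S : Finset (ℕ × ℕ)} {p : MvPolynomial (ℕ × ℕ) ℂ}
    (hp : p ∈ MvPolynomial.supported ℂ (T : Set (ℕ × ℕ))) :
    evalOutside T S p = Polynomial.C (MvPolynomial.aeval (fun _ => (1 : ℂ)) p) := by
  have h : MvPolynomial.supported ℂ (T : Set (ℕ × ℕ)) ≤ AlgHom.equalizer (evalOutside T S)
      (Polynomial.CAlgHom.comp (MvPolynomial.aeval fun _ => (1 : ℂ))) := by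
    rw [MvPolynomial.supported_eq_adjoin_X, Algebra.adjoin_le_iff]
    rintro _ ⟨d, hd, rfl⟩
    have : d ∈ T := hd
    simp [evalOutside, this]
  exact h hp

theorem coeff_evalOutside_Adj {m : ℕ} {T S : Finset (ℕ × ℕ)} (hS : S ⊆ diagonals m \ T) :
    (evalOutside T S (Adj m)).coeff ((diagonals m \ T) \ S).card =
      ((triangulations m).filter fun T' => T' \ T = S).card := by
  rw [Adj, map_sum, Polynomial.finsetSum_coeff, Finset.card_filter, Nat.cast_sum]
  refine Finset.sum_congr rfl fun T' hT' => ?_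
  have hT'' : T' ⊆ diagonals m := fun p hp =>
    mem_diagonals.2 ((mem_triangulations.1 hT').2.1 p hp)
  rw [map_prod]
  simp only [evalOutside, MvPolynomial.aeval_X]
  by_cases hST : S ⊆ T'
  · have h1 : ∏ d ∈ diagonals m \ T', (if d ∈ T then (1 : Polynomial ℂ) else if d ∈ S then 0
        else Polynomial.X) = Polynomial.X ^ ((diagonals m \ T) \ T').card := by
      rw [← Finset.prod_const, sdiff_right_comm, ← Finset.filter_notMem_eq_sdiff (t := T),
        Finset.prod_filter]
      refine Finset.prod_congr rfl fun d hd => ?_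
      have hdS : d ∉ S := fun h => (Finset.mem_sdiff.1 hd).2 (hST h)
      by_cases hdT : d ∈ T <;> simp [hdT, hdS]
    have hsub : (diagonals m \ T) \ T' ⊆ (diagonals m \ T) \ S :=
      Finset.sdiff_subset_sdiff le_rfl hST
    rw [h1, Polynomial.coeff_X_pow]
    have : ((diagonals m \ T) \ S).card = ((diagonals m \ T) \ T').card ↔ T' \ T = S := by
      constructor
      · intro h
        have := Finset.eq_of_subset_of_card_le hsub h.le
        ext d
        have h3 := Finset.ext_iff.1 this d
        have h4 := @hS d
        have h5 := @hT'' d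
        have h6 := @hST d
        simp only [Finset.mem_sdiff] at *
        tauto
      · rintro rfl
        congr 1
        ext d
        simp only [Finset.mem_sdiff]
        tauto
    simp [this]
  · rw [if_neg (fun h : T' \ T = S => hST (h ▸ Finset.sdiff_subset))]
    obtain ⟨d, hdS, hd⟩ := Finset.not_subset.1 hST
    have h2 := Finset.mem_sdiff.1 (hS hdS)
    rw [Finset.prod_eq_zero (Finset.mem_sdiff.2 ⟨h2.1, hd⟩)]
    · simp
    · simp [h2.2, hdS]

theorem card_filter_triangulations {m n : ℕ} {T : Finset (ℕ × ℕ)} (hT : IsTriangulation m T)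
    {s : List (ℕ × ℕ)} (hs : IsExpected m T s n) :
    ((triangulations m).filter fun T' => T' \ T = s.toFinset).card = n := by
  obtain ⟨hnd, hd, hlen, rfl⟩ := hs
  have hcard : s.toFinset.card = s.length := List.toFinset_card_of_nodup hnd
  have hsplit : (crossed T s).card + (T.filter fun t => ¬ ∃ x ∈ s, Crossing x t).card = T.card :=
    Finset.card_filter_add_card_filter_not _
  have hsub {T' : Finset (ℕ × ℕ)} (hT' : IsTriangulation m T') (h : T' \ T = s.toFinset) :
      T' ∩ T ⊆ T.filter fun t => ¬ ∃ x ∈ s, Crossing x t := by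
    intro t ht
    rw [Finset.mem_inter] at ht
    refine Finset.mem_filter.2 ⟨ht.2, fun ⟨x, hx, hxt⟩ => hT'.2.2 x ?_ t ht.1 hxt⟩
    rw [← List.mem_toFinset, ← h] at hx
    exact (Finset.mem_sdiff.1 hx).1
  have hadd {T' : Finset (ℕ × ℕ)} (h : T' \ T = s.toFinset) :
      s.length + (T' ∩ T).card = T'.card := by
    rw [← hcard, ← h, Finset.card_sdiff_add_card_inter]
  unfold expectedMinor
  split_ifs with hc
  · rw [Finset.card_eq_one]
    refine ⟨s.toFinset ∪ T.filter fun t => ¬ ∃ x ∈ s, Crossing x t, ?_⟩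
    ext T'
    rw [Finset.mem_filter, Finset.mem_singleton, mem_triangulations]
    constructor
    · rintro ⟨hT', h⟩
      have h1 := hadd h
      have h2 := hT.1
      have h3 := hT'.1
      rw [← Finset.sdiff_union_inter T' T, h,
        Finset.eq_of_subset_of_card_le (hsub hT' h) (by omega)]
    · rintro rfl
      refine ⟨⟨?_, ?_, ?_⟩, ?_⟩
      · rw [Finset.card_union_of_disjoint, hcard, ← hT.1]
        · omega
        · rw [Finset.disjoint_left]
          intro x hx hx'
          exact (hd x (List.mem_toFinset.1 hx)).2 (Finset.mem_filter.1 hx').1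
      · intro p hp
        simp only [Finset.mem_union, List.mem_toFinset, Finset.mem_filter] at hp
        rcases hp with hp | hp
        · exact (hd p hp).1
        · exact hT.2.1 p hp.1
      · intro p hp q hq hpq
        simp only [Finset.mem_union, List.mem_toFinset, Finset.mem_filter] at hp hq
        rcases hp with hp | hp <;> rcases hq with hq | hq
        · exact hc.1 p hp q hq hpq
        · exact hq.2 ⟨p, hp, hpq⟩
        · exact hp.2 ⟨q, hq, crossing_comm.1 hpq⟩
        · exact hT.2.2 p hp.1 q hq.1 hpq
      · ext x
        have := hd x
        simp only [Finset.mem_union, List.mem_toFinset, Finset.mem_filter, Finset.mem_sdiff]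
        tauto
  · rw [Finset.card_eq_zero, Finset.filter_eq_empty_iff]
    intro T' hT' h
    rw [mem_triangulations] at hT'
    refine hc ⟨fun x hx y hy => ?_, ?_⟩
    · rw [← List.mem_toFinset, ← h] at hx hy
      exact hT'.2.2 x (Finset.mem_sdiff.1 hx).1 y (Finset.mem_sdiff.1 hy).1
    · have h1 := hadd h
      have h2 := hT.1
      have h3 := hT'.1
      have h4 := Finset.card_le_card (hsub hT' h)
      omega

theorem minor_eq_det_submatrix {ι : Type*} [Fintype ι] [DecidableEq ι] (M : Matrix ι ι ℂ)
    (s : List ι) (hs : s.Nodup) :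
    minor M s = (M.submatrix ((↑) : s.toFinset → ι) (↑)).det := by
  let e : Fin s.length ≃ s.toFinset :=
    (List.Nodup.getEquiv s hs).trans (Equiv.subtypeEquivRight fun x => by simp)
  rw [← Matrix.det_submatrix_equiv_self e]
  rfl

theorem HasAVRep.exists_hasMinors {m : ℕ} (h : HasAVRep m) :
    ∃ T, IsTriangulation m T ∧ HasMinors m T := by
  classical
  obtain ⟨T, hT, A, hA, hdet⟩ := h
  refine ⟨T, hT, fun i j => if h : i ∈ diagonals m \ T ∧ j ∈ diagonals m \ T then
    MvPolynomial.aeval (fun _ => (1 : ℂ)) (A ⟨i, h.1⟩ ⟨j, h.2⟩) else 0, fun s n hs => ?_⟩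
  have hmem : ∀ x ∈ s, x ∈ diagonals m \ T := fun x hx =>
    Finset.mem_sdiff.2 ⟨mem_diagonals.2 (hs.2.1 x hx).1, (hs.2.1 x hx).2⟩
  obtain ⟨s, rfl⟩ : ∃ s' : List {d // d ∈ diagonals m \ T}, s'.map (↑) = s :=
    ⟨s.attachWith _ hmem, List.attachWith_map_subtype_val _⟩
  have hnd : s.Nodup := List.Nodup.of_map _ hs.1
  have hsub : (s.map (↑)).toFinset ⊆ diagonals m \ T := fun x hx => hmem x (List.mem_toFinset.1 hx)
  rw [minor_map]
  rw [← card_filter_triangulations hT hs, ← coeff_evalOutside_Adj hsub, hdet, AlgHom.map_det]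
  have h2 := coeff_det_diagonal_add
    (Matrix.of fun i j => MvPolynomial.aeval (fun _ => (1 : ℂ)) (A i j)) s.toFinset
  have h3 : ((diagonals m \ T) \ (s.map (↑)).toFinset).card = s.toFinsetᶜ.card := by
    rw [Finset.card_compl, Finset.card_sdiff_of_subset hsub, List.toFinset_card_of_nodup hs.1,
      List.toFinset_card_of_nodup hnd, List.length_map, Fintype.card_coe]
  have h4 : (fun i j : {d // d ∈ diagonals m \ T} =>
      if h : i.1 ∈ diagonals m \ T ∧ j.1 ∈ diagonals m \ T then
        MvPolynomial.aeval (fun _ => (1 : ℂ)) (A ⟨i, h.1⟩ ⟨j, h.2⟩) else 0) =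
      Matrix.of fun i j => MvPolynomial.aeval (fun _ => (1 : ℂ)) (A i j) := by
    ext i j
    exact dif_pos ⟨i.2, j.2⟩
  rw [h4, h3, minor_eq_det_submatrix _ s hnd, ← h2]
  congr 2
  ext1 i j
  have hi := Finset.mem_sdiff.1 i.2
  have hij := evalOutside_of_mem_supported (S := (s.map (↑)).toFinset) (hA i j)
  by_cases h : i = j
  · subst h
    have hX : evalOutside T (s.map (↑)).toFinset (MvPolynomial.X i.1) =
        if i ∈ s.toFinset then 0 else Polynomial.X := by
      simp [evalOutside, hi.1, hi.2]
    simp [hij, hX]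
  · simp [h, hij]

/-- An inconsistent system of principal minors at a diagonal and a cyclic sequence of five others. -/
def fanMinors (l : List (ℕ × ℕ)) : List (List (ℕ × ℕ) × ℕ) :=
  match l with
  | [d, a, b, c, e, f] =>
    [([d], 0), ([d, a], 0), ([d, b], 0), ([d, c], 0), ([d, e], 0), ([d, f], 0),
      ([d, a, b], 1), ([d, b, c], 1), ([d, c, e], 1), ([d, e, f], 1), ([d, f, a], 1)]
  | _ => []

/-- An inconsistent system of principal minors at five diagonals. -/
def zigMinors (l : List (ℕ × ℕ)) : List (List (ℕ × ℕ) × ℕ) :=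
  match l with
  | [a, b, c, d, e] =>
    [([a], 1), ([b], 0), ([c], 1), ([d], 0), ([e], 1),
      ([a, b], 0), ([a, c], 0), ([a, d], 0), ([a, e], 1), ([b, c], 0), ([b, d], 0), ([b, e], 0),
      ([c, d], 0), ([c, e], 1), ([d, e], 1),
      ([a, b, c], 0), ([a, b, e], 1), ([a, c, d], 0), ([a, d, e], 0), ([b, c, d], 0),
      ([b, c, e], 0), ([b, d, e], 1), ([c, d, e], 1), ([b, c, d, e], 0)]
  | _ => []

section
variable {ι : Type*} (M : ι → ι → ℂ) (a b c d : ι)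

theorem minor_one : minor M [a] = M a a := by
  simp [minor]

theorem minor_two : minor M [a, b] = M a a * M b b - M a b * M b a := by
  exact Matrix.det_fin_two _

theorem minor_three : minor M [a, b, c] = M a a * M b b * M c c - M a a * M b c * M c b
    - M a b * M b a * M c c + M a b * M b c * M c a + M a c * M b a * M c b
    - M a c * M b b * M c a := by
  exact Matrix.det_fin_three _

theorem minor_four : minor M [a, b, c, d] =
    M a a * minor M [b, c, d]
    - M a b * (M b a * (M c c * M d d - M c d * M d c) - M b c * (M c a * M d d - M c d * M d a)
        + M b d * (M c a * M d c - M c c * M d a))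
    + M a c * (M b a * (M c b * M d d - M c d * M d b) - M b b * (M c a * M d d - M c d * M d a)
        + M b d * (M c a * M d b - M c b * M d a))
    - M a d * (M b a * (M c b * M d c - M c c * M d b) - M b b * (M c a * M d c - M c c * M d a)
        + M b c * (M c a * M d b - M c b * M d a)) := by
  rw [minor_three]
  change Matrix.det (n := Fin 4) _ = _
  rw [Matrix.det_succ_row_zero]
  simp [Fin.sum_univ_succ, Matrix.det_fin_three, Fin.succAbove]
  ring
end

theorem minor_swap {ι : Type*} (M : ι → ι → ℂ) (s : List ι) :
    minor (fun i j => M j i) s = minor M s := by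
  unfold minor
  rw [← Matrix.det_transpose]
  rfl

theorem fan_false (M : ℕ × ℕ → ℕ × ℕ → ℂ) (a b c d e f : ℕ × ℕ)
    (h : ∀ x ∈ fanMinors [d, a, b, c, e, f], minor M x.1 = x.2) : False := by
  simp only [fanMinors, List.forall_mem_cons, minor_one, minor_two, minor_three] at h
  obtain ⟨h0, h1, h2, h3, h4, h5, h6, h7, h8, h9, h10, -⟩ := h
  have key : ∀ u v, M d u * M u d = 0 → M d v * M v d = 0 →
      M d u * M u v * M v d + M d v * M u d * M v u = 1 →
      ((M d u ≠ 0 ∧ M d v = 0) ∨ (M d u = 0 ∧ M d v ≠ 0)) := by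
    intro u v hu hv huv
    by_cases h1 : M d u = 0 <;> by_cases h2 : M d v = 0 <;> simp_all
  simp only [h0, Nat.cast_zero, zero_mul, zero_sub, neg_eq_zero,
    Nat.cast_one] at h1 h2 h3 h4 h5 h6 h7 h8 h9 h10
  have k1 := key a b h1 h2 (by linear_combination h6 + M b b * h1 + M a a * h2)
  have k2 := key b c h2 h3 (by linear_combination h7 + M c c * h2 + M b b * h3)
  have k3 := key c e h3 h4 (by linear_combination h8 + M e e * h3 + M c c * h4)
  have k4 := key e f h4 h5 (by linear_combination h9 + M f f * h4 + M e e * h5)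
  have k5 := key f a h5 h1 (by linear_combination h10 + M a a * h5 + M f f * h1)
  tauto

theorem zig_false_of_ne_zero (M : ℕ × ℕ → ℕ × ℕ → ℂ) (a b c d e : ℕ × ℕ)
    (h : ∀ x ∈ zigMinors [a, b, c, d, e], minor M x.1 = x.2) (hne : M b d * M d e * M e b ≠ 0) :
    False := by
  simp only [zigMinors, List.forall_mem_cons, minor_one, minor_two, minor_three,
    minor_four] at h
  obtain ⟨ha, hb, hc, hd, he, hab, hac, had, hae, hbc, hbd, hbe, hcd, hce, hde, habc, habe, hacd,
    hade, hbcd, hbce, hbde, hcde, hbcde, -⟩ := h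
  simp only [ha, hb, hc, hd, he, Nat.cast_zero, zero_mul, mul_zero, one_mul, mul_one, zero_sub,
    sub_zero, neg_eq_zero, Nat.cast_one] at *
  simp only [ne_eq, mul_eq_zero, not_or] at hne
  obtain ⟨⟨nbd, nde⟩, neb⟩ := hne
  have zdb : M d b = 0 := by simpa [nbd] using hbd
  have zbe : M b e = 0 := by simpa [neb] using hbe
  simp only [zdb, zbe, zero_mul, mul_zero, zero_sub, sub_zero, add_zero, zero_add] at *
  have ned : M e d ≠ 0 := by rintro h; simp [h] at hde
  have nba : M b a ≠ 0 := by rintro h; simp [h] at habe hab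
  have nae : M a e ≠ 0 := by rintro h; simp [h] at habe hab; simp_all
  have zab : M a b = 0 := by simpa [nba] using hab
  have zea : M e a = 0 := by simpa [nae] using hae
  have nda : M d a ≠ 0 := by rintro h; simp [h, zea] at hade; grind
  have zad : M a d = 0 := by simpa [nda] using had
  have nac : M a c ≠ 0 := by rintro h; simp [h] at hac
  have zcb : M c b = 0 := by simp [zab] at habc; grind
  have zcd : M c d = 0 := by simp [zad] at hacd; grind
  have zce : M c e * M d c = 0 := by simp [zcd] at hcde; grind
  simp only [zcb, zcd] at *
  grind

theorem zig_false (M : ℕ × ℕ → ℕ × ℕ → ℂ) (a b c d e : ℕ × ℕ)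
    (h : ∀ x ∈ zigMinors [a, b, c, d, e], minor M x.1 = x.2) : False := by
  by_cases h1 : M b d * M d e * M e b = 0
  · refine zig_false_of_ne_zero (fun i j => M j i) a b c d e ?_ ?_
    · simpa only [minor_swap] using h
    · simp only [zigMinors, List.forall_mem_cons, minor_one, minor_two, minor_three] at h
      intro h2
      grind
  · exact zig_false_of_ne_zero M a b c d e h h1

/-- The rotation of the heptagon by `r + 1` steps, acting on diagonals. -/
def rot (r : ℕ) (p : ℕ × ℕ) : ℕ × ℕ :=
  (min ((p.1 + r) % 7 + 1) ((p.2 + r) % 7 + 1), max ((p.1 + r) % 7 + 1) ((p.2 + r) % 7 + 1))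

/-- The reflection `x ↦ 8 - x` of the heptagon, acting on diagonals. -/
def reflect (p : ℕ × ℕ) : ℕ × ℕ := (8 - p.2, 8 - p.1)

/-- The diagonals of the heptagon. -/
def diagonalsSeven : List (ℕ × ℕ) :=
  [(1, 3), (1, 4), (1, 5), (1, 6), (2, 4), (2, 5), (2, 6), (2, 7), (3, 5), (3, 6), (3, 7), (4, 6),
    (4, 7), (5, 7)]

/-- Configurations of diagonals of the heptagon whose minors are tested by `fanMinors`. -/
def fans : List (List (ℕ × ℕ)) :=
  [[(2, 6), (2, 4), (2, 5), (3, 5), (3, 6), (4, 6)],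
    [(1, 3), (3, 5), (3, 6), (4, 6), (1, 4), (1, 5)],
    [(2, 4), (4, 6), (1, 4), (1, 5), (2, 5), (2, 6)]]

/-- Configurations of diagonals of the heptagon whose minors are tested by `zigMinors`. -/
def zigs : List (List (ℕ × ℕ)) :=
  [[(1, 4), (1, 5), (2, 7), (3, 5), (5, 7)]]

/-- Up to a symmetry of the heptagon, one of the inconsistent systems `fanMinors` and `zigMinors` of
principal minors is forced by the triangulation `T`. -/
def HasObstruction (T : Finset (ℕ × ℕ)) : Prop :=
  ∃ r ∈ List.range 7, ∃ σ ∈ [id, reflect],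
    (∃ l ∈ fans, ∀ x ∈ fanMinors (l.map fun p => rot r (σ p)), IsExpected 7 T x.1 x.2) ∨
    (∃ l ∈ zigs, ∀ x ∈ zigMinors (l.map fun p => rot r (σ p)), IsExpected 7 T x.1 x.2)

instance (T : Finset (ℕ × ℕ)) : Decidable (HasObstruction T) := by
  unfold HasObstruction; infer_instance

theorem hasObstruction_of_mem_sublistsLen :
    ∀ L ∈ diagonalsSeven.sublistsLen 4,
      NonCrossing L → HasObstruction L.toFinset := by
  decide +kernel

theorem IsTriangulation.hasObstruction {T : Finset (ℕ × ℕ)} (hT : IsTriangulation 7 T) :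
    HasObstruction T := by
  have hmem : ∀ p, IsDiag 7 p → p ∈ diagonalsSeven := by
    have h : ∀ i ∈ List.range 8, ∀ j ∈ List.range 8,
        IsDiag 7 (i, j) → (i, j) ∈ diagonalsSeven := by decide
    intro p hp
    have hp' := hp
    simp only [IsDiag] at hp'
    exact h p.1 (List.mem_range.2 (by omega)) p.2 (List.mem_range.2 (by omega)) hp
  have hnd : (diagonalsSeven.filter (· ∈ T)).Nodup :=
    List.Nodup.filter _ (by decide : diagonalsSeven.Nodup)
  have hL : (diagonalsSeven.filter (· ∈ T)).toFinset = T := by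
    ext p
    simp only [List.mem_toFinset, List.mem_filter, decide_eq_true_eq, and_iff_right_iff_imp]
    exact fun hp => hmem p (hT.2.1 p hp)
  have h := hasObstruction_of_mem_sublistsLen (diagonalsSeven.filter (· ∈ T))
    (List.mem_sublistsLen.2 ⟨List.filter_sublist, by
      rw [← List.toFinset_card_of_nodup hnd, hL, hT.1]⟩)
    (fun x hx y hy => hT.2.2 x (by simpa using (List.mem_filter.1 hx).2) y
      (by simpa using (List.mem_filter.1 hy).2))
  rwa [hL] at h

theorem HasObstruction.not_hasMinors {T : Finset (ℕ × ℕ)} (h : HasObstruction T) :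
    ¬ HasMinors 7 T := by
  rintro ⟨M, hM⟩
  obtain ⟨r, -, σ, -, ⟨l, hl, h⟩ | ⟨l, hl, h⟩⟩ := h
  · simp only [fans, List.mem_cons, List.not_mem_nil, or_false] at hl
    rcases hl with rfl | rfl | rfl <;> simp only [List.map_cons, List.map_nil] at h <;>
      exact fan_false M _ _ _ _ _ _ fun x hx => hM _ _ (h x hx)
  · simp only [zigs, List.mem_cons, List.not_mem_nil, or_false] at hl
    subst hl
    simp only [List.map_cons, List.map_nil] at h
    exact zig_false M _ _ _ _ _ fun x hx => hM _ _ (h x hx)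

theorem stmt_13 (m : ℕ) (hm : 7 ≤ m) : ¬ HasAVRep m := by
  intro h
  obtain ⟨T, hT, hM⟩ := h.exists_hasMinors
  obtain ⟨T', hT', hM'⟩ := exists_hasMinors_seven hm hT hM
  exact hT'.hasObstruction.not_hasMinors hM'
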